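/- arXiv:math/0612047 — 5 statements merged into one kernel-verified Lean document; each statement's English description precedes it below -/
import Mathlib

section
/- Let D be a nonnegative linear combination of pure diagrams of codimension 3 such that row 0 of D has exactly one nonzero entry and row 3 of D has exactly one nonzero entry. Then D can be written as D = Σ_{k=1}^m a_k π_k where each a_k is a nonnegative rational, each π_k is a pure diagram of codimension 3 with nonnegative entries, and the types of π_1, ..., π_m form a chain, i.e. for all k and l the type of π_k and the type of π_l are comparable in the componentwise partial order on strictly increasing integer sequences of length 4. -/
/-- The alternating-sign Laurent polynomial `S_D(t) = Σ_{i,j} (-1)^i D(i,j) t^j`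
associated to a diagram `D : ℤ × ℤ → ℚ`. -/
noncomputable def SPoly (D : ℤ × ℤ → ℚ) : LaurentPolynomial ℚ :=
  ∑ᶠ q : ℤ × ℤ, LaurentPolynomial.C ((-1 : ℚ) ^ q.1 * D q) * LaurentPolynomial.T q.2

/-- A diagram of codimension `p`. -/
structure IsDiagram (p : ℕ) (D : ℤ × ℤ → ℚ) : Prop where
  finite : (Function.support D).Finite
  zero_outside : ∀ i j : ℤ, i < 0 ∨ (p : ℤ) < i → D (i, j) = 0
  dvd : (1 - LaurentPolynomial.T 1) ^ p ∣ SPoly D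

/-- A pure diagram of type `d` of codimension `p`. -/
structure IsPureDiagram (p : ℕ) (d : Fin (p + 1) → ℤ) (D : ℤ × ℤ → ℚ) : Prop where
  diagram : IsDiagram p D
  strictMono : StrictMono d
  pure : ∀ (k : Fin (p + 1)) (j : ℤ), j ≠ d k → D (((k : ℕ) : ℤ), j) = 0

/-- `D` is a nonnegative linear combination of pure diagrams of codimension `p`
(each with nonnegative entries). -/
def IsNonnegCombPure (p : ℕ) (D : ℤ × ℤ → ℚ) : Prop :=
  ∃ (n : ℕ) (a : Fin n → ℚ) (P : Fin n → (ℤ × ℤ → ℚ)) (t : Fin n → (Fin (p + 1) → ℤ)),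
    (∀ k, 0 ≤ a k) ∧ (∀ k, IsPureDiagram p (t k) (P k)) ∧
    (∀ k q, 0 ≤ P k q) ∧ D = ∑ k, a k • P k

/-- The sequence `(d₀, j+1, j+2, …, j+p-1, dₚ)`. -/
def midType (p : ℕ) (d0 j dp : ℤ) : Fin (p + 1) → ℤ :=
  fun k => if (k : ℕ) = 0 then d0 else if (k : ℕ) = p then dp else j + ((k : ℕ) : ℤ)

/-- An extremely compressed diagram of codimension `p`: a pure diagram of type
`(d₀, j+1, …, j+p-1, c+p)` for some `d₀ ≤ j ≤ c`. -/
def IsECDiagram (p : ℕ) (D : ℤ × ℤ → ℚ) : Prop :=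
  ∃ d0 j c : ℤ, d0 ≤ j ∧ j ≤ c ∧ IsPureDiagram p (midType p d0 j (c + (p : ℤ))) D

/-- `D` is a nonnegative linear combination of extremely compressed diagrams. -/
def IsNonnegCombEC (p : ℕ) (D : ℤ × ℤ → ℚ) : Prop :=
  ∃ (n : ℕ) (a : Fin n → ℚ) (P : Fin n → (ℤ × ℤ → ℚ)),
    (∀ k, 0 ≤ a k) ∧ (∀ k, IsECDiagram p (P k)) ∧ (∀ k q, 0 ≤ P k q) ∧ D = ∑ k, a k • P k

/-- The consecutive-cancellation diagram `C^{k,l}`. -/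
def Ccan (k l : ℤ) : ℤ × ℤ → ℚ := fun q => if q = (k, l) ∨ q = (k + 1, l) then 1 else 0

/-- `D` is obtained from `E` by a sequence of consecutive cancellations. -/
def ObtainedByCancel (E D : ℤ × ℤ → ℚ) : Prop :=
  ∃ b : ℤ × ℤ → ℚ, (Function.support b).Finite ∧ (∀ q, 0 ≤ b q) ∧ (∀ q, 0 ≤ D q) ∧
    ∀ q, D q = E q - ∑ᶠ r : ℤ × ℤ, b r * Ccan r.1 r.2 q

/-- The Laurent polynomial `Σ_j h_j t^j` of a coefficient function `h : ℤ → ℚ`. -/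
noncomputable def rowPoly (h : ℤ → ℚ) : LaurentPolynomial ℚ :=
  ∑ᶠ j : ℤ, LaurentPolynomial.C (h j) * LaurentPolynomial.T j

/-- `r_i = binom(p-1+i, p-1)` for `i ≥ 0`, and `0` for `i < 0`. -/
def rr (p : ℕ) (i : ℤ) : ℚ :=
  if i < 0 then 0 else (Nat.choose (p - 1 + i.toNat) (p - 1) : ℚ)

/-- Coefficients of the normalized `h`-vector of the extremely compressed diagram
of type `(0, j+1, …, j+p-1, c+p)`. -/
def hpi (p c j : ℕ) (i : ℤ) : ℚ :=
  if 0 ≤ i ∧ i ≤ (j : ℤ) then rr p i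
  else if (j : ℤ) < i ∧ i ≤ (c : ℤ) then rr p (j : ℤ) / rr p ((c : ℤ) - (j : ℤ)) * rr p ((c : ℤ) - i)
  else 0

namespace Stmt13Aux

open LaurentPolynomial

/-- Linear functional on Laurent polynomials pairing coefficients with `f`. -/
noncomputable def mom (f : ℤ → ℚ) : LaurentPolynomial ℚ →ₗ[ℚ] ℚ :=
  (Finsupp.lsum ℚ (fun n => (f n) • (LinearMap.id : ℚ →ₗ[ℚ] ℚ))) ∘ₗ
    (AddMonoidAlgebra.coeffLinearEquiv ℚ).toLinearMap

lemma mom_CT (f : ℤ → ℚ) (a : ℚ) (n : ℤ) :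
    mom f (LaurentPolynomial.C a * LaurentPolynomial.T n) = f n * a := by
  rw [← LaurentPolynomial.single_eq_C_mul_T]
  have : (AddMonoidAlgebra.coeffLinearEquiv ℚ) (AddMonoidAlgebra.single n a) =
    Finsupp.single n a := rfl
  simp [mom, this, -LaurentPolynomial.single_eq_C_mul_T]

lemma mom_dvd (f : ℤ → ℚ) (hf : ∀ n, f n - 3 * f (n + 1) + 3 * f (n + 2) - f (n + 3) = 0)
    (g : LaurentPolynomial ℚ) (hg : (1 - LaurentPolynomial.T 1) ^ 3 ∣ g) : mom f g = 0 := by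
  obtain ⟨q, rfl⟩ := hg
  induction q using LaurentPolynomial.induction_on' with
  | add p q hp hq => rw [mul_add, map_add, hp, hq, add_zero]
  | C_mul_T n a =>
    have : (1 - LaurentPolynomial.T 1) ^ 3 * (LaurentPolynomial.C a * LaurentPolynomial.T n) =
        LaurentPolynomial.C a * LaurentPolynomial.T n
        - LaurentPolynomial.C (3 * a) * LaurentPolynomial.T (n + 1)
        + LaurentPolynomial.C (3 * a) * LaurentPolynomial.T (n + 2)
        - LaurentPolynomial.C a * LaurentPolynomial.T (n + 3) := by
      have h2 : (LaurentPolynomial.T 2 : LaurentPolynomial ℚ) = LaurentPolynomial.T 1 ^ 2 := by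
        simp
      have h3 : (LaurentPolynomial.T 3 : LaurentPolynomial ℚ) = LaurentPolynomial.T 1 ^ 3 := by
        simp
      rw [LaurentPolynomial.T_add, LaurentPolynomial.T_add, LaurentPolynomial.T_add, h2, h3,
        map_mul]
      have : (LaurentPolynomial.C (3 : ℚ)) = 3 := map_ofNat _ 3
      rw [this]
      ring
    rw [this, map_sub, map_add, map_sub, mom_CT, mom_CT, mom_CT, mom_CT]
    linear_combination a * hf n

/-- Second order Taylor polynomial of `T n` at `T = 1`. -/
noncomputable def tay (n : ℤ) : LaurentPolynomial ℚ :=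
  1 + LaurentPolynomial.C (n : ℚ) * (LaurentPolynomial.T 1 - 1) +
    LaurentPolynomial.C ((n : ℚ) * (n - 1) / 2) * (LaurentPolynomial.T 1 - 1) ^ 2

lemma tay_succ (n : ℤ) : LaurentPolynomial.T (n + 1) - tay (n + 1) =
    LaurentPolynomial.T 1 * (LaurentPolynomial.T n - tay n) +
    (1 - LaurentPolynomial.T 1) ^ 3 * (-LaurentPolynomial.C ((n : ℚ) * (n - 1) / 2)) := by
  have h : LaurentPolynomial.C (((n + 1 : ℤ) : ℚ) * (((n + 1 : ℤ) : ℚ) - 1) / 2) =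
      LaurentPolynomial.C ((n : ℚ) * (n - 1) / 2) + LaurentPolynomial.C (n : ℚ) := by
    rw [← map_add]; congr 1; push_cast; ring
  have h' : LaurentPolynomial.C (((n + 1 : ℤ) : ℚ)) = LaurentPolynomial.C (n : ℚ) + 1 := by
    push_cast; simp
  rw [tay, tay, h, h', LaurentPolynomial.T_add]
  ring

lemma tay_dvd (n : ℤ) : (1 - LaurentPolynomial.T 1) ^ 3 ∣ LaurentPolynomial.T n - tay n := by
  induction n using Int.induction_on with
  | zero => simp [tay]
  | succ n ih =>
    rw [tay_succ]
    exact dvd_add (ih.mul_left _) (dvd_mul_right _ _)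
  | pred n ih =>
    have h := tay_succ (-(n : ℤ) - 1)
    rw [sub_add_cancel] at h
    rw [h] at ih
    have h2 := (dvd_add_left (dvd_mul_right _ _)).1 ih
    have h3 := h2.mul_left (LaurentPolynomial.T (-1))
    rwa [← mul_assoc, ← LaurentPolynomial.T_add, neg_add_cancel, LaurentPolynomial.T_zero,
      one_mul] at h3

lemma dvd_of_moments (a b c e : ℚ) (l x y h : ℤ) (m0 : a - b + c - e = 0)
    (m1 : a * l - b * x + c * y - e * h = 0)
    (m2 : a * l ^ 2 - b * x ^ 2 + c * y ^ 2 - e * h ^ 2 = 0) :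
    (1 - LaurentPolynomial.T 1) ^ 3 ∣
      LaurentPolynomial.C a * LaurentPolynomial.T l
      - LaurentPolynomial.C b * LaurentPolynomial.T x
      + LaurentPolynomial.C c * LaurentPolynomial.T y
      - LaurentPolynomial.C e * LaurentPolynomial.T h := by
  have key : LaurentPolynomial.C a * tay l - LaurentPolynomial.C b * tay x
      + LaurentPolynomial.C c * tay y - LaurentPolynomial.C e * tay h = 0 := by
    have e0 : LaurentPolynomial.C (a - b + c - e) = 0 := by rw [m0, map_zero]
    have e1 : LaurentPolynomial.C (a * l - b * x + c * y - e * h) = 0 := by rw [m1, map_zero]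
    have e2 : LaurentPolynomial.C (a * (l * (l - 1) / 2) - b * (x * (x - 1) / 2)
        + c * (y * (y - 1) / 2) - e * (h * (h - 1) / 2)) = 0 := by
      rw [← map_zero LaurentPolynomial.C]; congr 1
      linear_combination (m2 - m1) / 2
    simp only [map_add, map_sub, map_mul] at e0 e1
    rw [map_sub, map_add, map_sub, map_mul, map_mul _ b, map_mul _ c, map_mul _ e] at e2
    unfold tay
    linear_combination e0 + e1 * (LaurentPolynomial.T 1 - 1) +
      e2 * (LaurentPolynomial.T 1 - 1) ^ 2
  have := dvd_sub (dvd_add (dvd_sub ((tay_dvd l).mul_left (LaurentPolynomial.C a))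
    ((tay_dvd x).mul_left (LaurentPolynomial.C b))) ((tay_dvd y).mul_left (LaurentPolynomial.C c)))
    ((tay_dvd h).mul_left (LaurentPolynomial.C e))
  convert this using 1
  linear_combination key

lemma SPoly_four (D : ℤ × ℤ → ℚ) (l x y h : ℤ)
    (hs : ∀ q, q ≠ (0, l) → q ≠ (1, x) → q ≠ (2, y) → q ≠ (3, h) → D q = 0) :
    SPoly D = LaurentPolynomial.C (D (0, l)) * LaurentPolynomial.T l
      - LaurentPolynomial.C (D (1, x)) * LaurentPolynomial.T x
      + LaurentPolynomial.C (D (2, y)) * LaurentPolynomial.T y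
      - LaurentPolynomial.C (D (3, h)) * LaurentPolynomial.T h := by
  unfold SPoly
  rw [finsum_eq_sum_of_support_subset (s := {((0 : ℤ), l), (1, x), (2, y), (3, h)})]
  · rw [Finset.sum_insert (by simp), Finset.sum_insert (by simp), Finset.sum_insert (by simp),
      Finset.sum_singleton]
    have : ((-1 : ℚ) ^ (3 : ℤ)) = -1 := by norm_num
    simp [this]
    ring
  · intro q hq
    by_contra hc
    simp only [Finset.coe_insert, Finset.coe_singleton, Set.mem_insert_iff,
      Set.mem_singleton_iff, not_or] at hc
    apply hq
    simp [hs q hc.1 hc.2.1 hc.2.2.1 hc.2.2.2]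

/-- The part of the normalized pure diagram of type `(l,x,y,h)` that depends on `x`. -/
def partA (l h x : ℤ) : ℤ × ℤ → ℚ := fun q =>
  if q = (0, l) then 1 / (((h : ℚ) - l) * (x - l)) else
  if q = (1, x) then 1 / (((x : ℚ) - l) * (h - x)) else
  if q = (3, h) then - (1 / (((h : ℚ) - l) * (h - x))) else 0

/-- The part of the normalized pure diagram of type `(l,x,y,h)` that depends on `y`. -/
def partB (l h y : ℤ) : ℤ × ℤ → ℚ := fun q =>
  if q = (0, l) then - (1 / (((h : ℚ) - l) * (y - l))) else
  if q = (2, y) then 1 / (((y : ℚ) - l) * (h - y)) else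
  if q = (3, h) then 1 / (((h : ℚ) - l) * (h - y)) else 0

/-- Normalized pure diagram. -/
def pd (l h : ℤ) (p : ℤ × ℤ) : ℤ × ℤ → ℚ := partA l h p.1 + partB l h p.2

/-- The type of a normalized pure diagram. -/
def ty (l h : ℤ) (p : ℤ × ℤ) : Fin (3 + 1) → ℤ := ![l, p.1, p.2, h]

/-- Admissible pairs. -/
def Adm (l h : ℤ) (p : ℤ × ℤ) : Prop := l < p.1 ∧ p.1 < p.2 ∧ p.2 < h

lemma pd0 (l h x y : ℤ) : pd l h (x, y) (0, l) =
    1 / (((h : ℚ) - l) * (x - l)) - 1 / (((h : ℚ) - l) * (y - l)) := by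
  simp [pd, partA, partB]; ring

lemma pd1 (l h x y : ℤ) : pd l h (x, y) (1, x) = 1 / (((x : ℚ) - l) * (h - x)) := by
  simp [pd, partA, partB]

lemma pd2 (l h x y : ℤ) : pd l h (x, y) (2, y) = 1 / (((y : ℚ) - l) * (h - y)) := by
  simp [pd, partA, partB]

lemma pd3 (l h x y : ℤ) : pd l h (x, y) (3, h) =
    1 / (((h : ℚ) - l) * (h - y)) - 1 / (((h : ℚ) - l) * (h - x)) := by
  simp [pd, partA, partB]; ring

lemma pd_zero (l h x y : ℤ) (q : ℤ × ℤ) (h0 : q ≠ (0, l)) (h1 : q ≠ (1, x)) (h2 : q ≠ (2, y))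
    (h3 : q ≠ (3, h)) : pd l h (x, y) q = 0 := by
  simp [pd, partA, partB, h0, h1, h2, h3]

lemma pd_nonneg (l h : ℤ) (p : ℤ × ℤ) (hp : Adm l h p) (q : ℤ × ℤ) : 0 ≤ pd l h p q := by
  obtain ⟨x, y⟩ := p
  obtain ⟨hx, hxy, hy⟩ := hp
  simp only at hx hxy hy
  have hx' : (0 : ℚ) < x - l := by rw [sub_pos]; exact_mod_cast hx
  have hxy' : (x : ℚ) < y := by exact_mod_cast hxy
  have hy' : (0 : ℚ) < h - y := by rw [sub_pos]; exact_mod_cast hy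
  have hxh : (0 : ℚ) < h - x := by linarith
  have hyl : (0 : ℚ) < y - l := by linarith
  have hl : (0 : ℚ) < h - l := by linarith
  by_cases h0 : q = (0, l)
  · rw [h0, pd0, sub_nonneg]
    apply one_div_le_one_div_of_le (by positivity)
    gcongr
  by_cases h1 : q = (1, x)
  · rw [h1, pd1]; positivity
  by_cases h2 : q = (2, y)
  · rw [h2, pd2]; positivity
  by_cases h3 : q = (3, h)
  · rw [h3, pd3, sub_nonneg]
    apply one_div_le_one_div_of_le (by positivity)
    gcongr
  rw [pd_zero l h x y q h0 h1 h2 h3]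

lemma pd_pure (l h : ℤ) (p : ℤ × ℤ) (hp : Adm l h p) : IsPureDiagram 3 (ty l h p) (pd l h p) := by
  obtain ⟨x, y⟩ := p
  obtain ⟨hx, hxy, hy⟩ := hp
  simp only at hx hxy hy
  have hx' : (0 : ℚ) < x - l := by rw [sub_pos]; exact_mod_cast hx
  have hxy' : (x : ℚ) < y := by exact_mod_cast hxy
  have hy' : (0 : ℚ) < h - y := by rw [sub_pos]; exact_mod_cast hy
  have hxh : (0 : ℚ) < h - x := by linarith
  have hyl : (0 : ℚ) < y - l := by linarith
  have hl : (0 : ℚ) < h - l := by linarith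
  refine ⟨⟨?_, ?_, ?_⟩, ?_, ?_⟩
  · apply Set.Finite.subset (s := {((0 : ℤ), l), (1, x), (2, y), (3, h)})
    · exact Set.toFinite _
    · intro q hq
      by_contra hc
      simp only [Set.mem_insert_iff, Set.mem_singleton_iff, not_or] at hc
      exact hq (pd_zero l h x y q hc.1 hc.2.1 hc.2.2.1 hc.2.2.2)
  · intro i j hij
    apply pd_zero <;> · intro he; simp only [Prod.mk.injEq] at he; push_cast at hij; omega
  · rw [SPoly_four _ l x y h (pd_zero l h x y), pd0, pd1, pd2, pd3]
    apply dvd_of_moments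
    · field_simp; ring
    · field_simp; ring
    · field_simp; ring
  · rw [Fin.strictMono_iff_lt_succ]
    intro i
    fin_cases i
    · simpa [ty] using hx
    · simpa [ty] using hxy
    · simpa [ty] using hy
  · intro k j hj
    fin_cases k <;> apply pd_zero <;> simp_all [ty]

lemma pure_eq (d : Fin (3 + 1) → ℤ) (P : ℤ × ℤ → ℚ) (hP : IsPureDiagram 3 d P) :
    P = (P (1, d 1) * (((d 1 : ℚ) - d 0) * (d 3 - d 1))) • pd (d 0) (d 3) (d 1, d 2) := by
  have hm := hP.strictMono
  have hx : d 0 < d 1 := hm (by decide)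
  have hxy : d 1 < d 2 := hm (by decide)
  have hy : d 2 < d 3 := hm (by decide)
  have hs : ∀ q, q ≠ (0, d 0) → q ≠ (1, d 1) → q ≠ (2, d 2) → q ≠ (3, d 3) → P q = 0 := by
    rintro ⟨i, j⟩ h0 h1 h2 h3
    by_cases hi : i < 0 ∨ ((3 : ℕ) : ℤ) < i
    · exact hP.diagram.zero_outside i j hi
    · push_cast at hi
      have : i = 0 ∨ i = 1 ∨ i = 2 ∨ i = 3 := by omega
      rcases this with rfl | rfl | rfl | rfl
      · exact hP.pure 0 j (fun e => h0 (by rw [e]))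
      · exact hP.pure 1 j (fun e => h1 (by rw [e]))
      · exact hP.pure 2 j (fun e => h2 (by rw [e]))
      · exact hP.pure 3 j (fun e => h3 (by rw [e]))
  have hd := hP.diagram.dvd
  rw [SPoly_four P _ _ _ _ hs] at hd
  generalize d 0 = l at *
  generalize d 1 = x at *
  generalize d 2 = y at *
  generalize d 3 = h at *
  have hx' : (0 : ℚ) < x - l := by rw [sub_pos]; exact_mod_cast hx
  have hxy' : (0 : ℚ) < y - x := by rw [sub_pos]; exact_mod_cast hxy
  have hy' : (0 : ℚ) < h - y := by rw [sub_pos]; exact_mod_cast hy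
  have hxh : (0 : ℚ) < h - x := by linarith
  have hyl : (0 : ℚ) < y - l := by linarith
  have hl : (0 : ℚ) < h - l := by linarith
  have M : ∀ u v : ℚ, (((l : ℚ) - u) * (l - v)) * P (0, l) - (((x : ℚ) - u) * (x - v)) * P (1, x)
      + (((y : ℚ) - u) * (y - v)) * P (2, y) - (((h : ℚ) - u) * (h - v)) * P (3, h) = 0 := by
    intro u v
    have := mom_dvd (fun n => ((n : ℚ) - u) * (n - v)) (by intro n; push_cast; ring) _ hd
    simpa only [map_sub, map_add, mom_CT] using this
  have M1 := M l h
  have M2 := M x h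
  have M3 := M l x
  have e2 : P (2, y) = P (1, x) * ((x - l) * (h - x)) / ((y - l) * (h - y)) := by
    field_simp; linear_combination -M1
  funext q
  rw [Pi.smul_apply, smul_eq_mul]
  by_cases h0 : q = (0, l)
  · rw [h0, pd0]
    have : P (0, l) = P (2, y) * ((y - x) * (h - y)) / ((x - l) * (h - l)) := by
      field_simp; linear_combination M2
    rw [this, e2]; field_simp; ring
  by_cases h1 : q = (1, x)
  · rw [h1, pd1]; field_simp
  by_cases h2 : q = (2, y)
  · rw [h2, pd2, e2]; field_simp
  by_cases h3 : q = (3, h)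
  · rw [h3, pd3]
    have : P (3, h) = P (2, y) * ((y - x) * (y - l)) / ((h - x) * (h - l)) := by
      field_simp; linear_combination -M3
    rw [this, e2]; field_simp; ring
  rw [pd_zero l h x y q h0 h1 h2 h3, hs q h0 h1 h2 h3, mul_zero]

/-- Monotone rearrangement of a multiset of pairs `x < y`. -/
lemma rearrange (n : ℕ) : ∀ M : Multiset (ℤ × ℤ), M.card = n → (∀ p ∈ M, p.1 < p.2) →
    ∃ M' : Multiset (ℤ × ℤ), (∀ p ∈ M', p.1 < p.2) ∧
      M'.map Prod.fst = M.map Prod.fst ∧ M'.map Prod.snd = M.map Prod.snd ∧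
      ∀ p ∈ M', ∀ q ∈ M', p ≤ q ∨ q ≤ p := by
  induction n with
  | zero =>
    intro M hM _
    rw [Multiset.card_eq_zero] at hM
    exact ⟨0, by simp, by simp [hM], by simp [hM], by simp⟩
  | succ n ih =>
    intro M hM hlt
    have key : ∃ (x0 y0 : ℤ) (N : Multiset (ℤ × ℤ)), N.card = n ∧ x0 < y0 ∧ (∀ p ∈ N, p.1 < p.2) ∧
        (∀ x ∈ N.map Prod.fst, x0 ≤ x) ∧ (∀ y ∈ N.map Prod.snd, y0 ≤ y) ∧
        x0 ::ₘ N.map Prod.fst = M.map Prod.fst ∧ y0 ::ₘ N.map Prod.snd = M.map Prod.snd := by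
      have hne : M ≠ 0 := by rintro rfl; simp at hM
      obtain ⟨⟨x0, y1⟩, ha, hamin⟩ := Multiset.exists_min_image Prod.fst hne
      obtain ⟨⟨x1, y0⟩, hb, hbmin⟩ := Multiset.exists_min_image Prod.snd hne
      obtain ⟨R, rfl⟩ := Multiset.exists_cons_of_mem ha
      rw [Multiset.card_cons, Nat.add_right_cancel_iff] at hM
      by_cases hab : (x1, y0) = (x0, y1)
      · obtain ⟨rfl, rfl⟩ := Prod.mk.inj hab
        refine ⟨x1, y0, R, hM, hlt _ ha, fun p hp => hlt p (Multiset.mem_cons_of_mem hp), ?_, ?_,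
          by simp, by simp⟩
        · intro x hx
          obtain ⟨p, hp, rfl⟩ := Multiset.mem_map.1 hx
          exact hamin p (Multiset.mem_cons_of_mem hp)
        · intro x hx
          obtain ⟨p, hp, rfl⟩ := Multiset.mem_map.1 hx
          exact hbmin p (Multiset.mem_cons_of_mem hp)
      · have hb' := (Multiset.mem_cons.1 hb).resolve_left hab
        obtain ⟨S, rfl⟩ := Multiset.exists_cons_of_mem hb'
        have l1 := hlt _ ha
        have l2 := hlt _ hb
        have l3 := hamin _ hb
        have l4 := hbmin _ ha
        simp only at l1 l2 l3 l4
        refine ⟨x0, y0, (x1, y1) ::ₘ S, by simpa using hM, by omega, ?_, ?_, ?_, by simp, ?_⟩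
        · intro p hp
          rcases Multiset.mem_cons.1 hp with rfl | hp
          · simp only; omega
          · exact hlt p (by simp [hp])
        · intro x hx
          obtain ⟨p, hp, rfl⟩ := Multiset.mem_map.1 hx
          rcases Multiset.mem_cons.1 hp with rfl | hp
          · exact l3
          · exact hamin p (by simp [hp])
        · intro x hx
          obtain ⟨p, hp, rfl⟩ := Multiset.mem_map.1 hx
          rcases Multiset.mem_cons.1 hp with rfl | hp
          · exact l4
          · exact hbmin p (by simp [hp])
        · simp [Multiset.cons_swap]
    obtain ⟨x0, y0, N, hN, h00, hNlt, hx, hy, e1, e2⟩ := key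
    obtain ⟨N', g1, g2, g3, g4⟩ := ih N hN hNlt
    have hle : ∀ p ∈ N', (x0, y0) ≤ p := fun p hp =>
      ⟨hx _ (g2 ▸ Multiset.mem_map_of_mem Prod.fst hp),
        hy _ (g3 ▸ Multiset.mem_map_of_mem Prod.snd hp)⟩
    refine ⟨(x0, y0) ::ₘ N', ?_, by simp [g2, e1], by simp [g3, e2], ?_⟩
    · intro p hp
      rcases Multiset.mem_cons.1 hp with rfl | hp
      · exact h00
      · exact g1 p hp
    · intro p hp q hq
      rcases Multiset.mem_cons.1 hp with rfl | hp <;> rcases Multiset.mem_cons.1 hq with rfl | hq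
      · exact Or.inl le_rfl
      · exact Or.inl (hle q hq)
      · exact Or.inr (hle p hp)
      · exact g4 p hp q hq

/-- Diagrams some positive multiple of which is a finite sum of normalized pure diagrams. -/
def Good (l h : ℤ) (E : ℤ × ℤ → ℚ) : Prop :=
  ∃ N : ℕ, 0 < N ∧ ∃ M : Multiset (ℤ × ℤ), (∀ p ∈ M, Adm l h p) ∧
    (N : ℚ) • E = (M.map (pd l h)).sum

lemma Good.zero (l h : ℤ) : Good l h 0 := ⟨1, one_pos, 0, by simp, by simp⟩

lemma Good.add {l h : ℤ} {E F : ℤ × ℤ → ℚ} (hE : Good l h E) (hF : Good l h F) :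
    Good l h (E + F) := by
  obtain ⟨N, hN, M, hM, e⟩ := hE
  obtain ⟨N', hN', M', hM', e'⟩ := hF
  refine ⟨N * N', Nat.mul_pos hN hN', N' • M + N • M', ?_, ?_⟩
  · intro p hp
    rcases Multiset.mem_add.1 hp with hp | hp
    · exact hM p (Multiset.mem_of_mem_nsmul hp)
    · exact hM' p (Multiset.mem_of_mem_nsmul hp)
  · rw [Multiset.map_add, Multiset.sum_add, Multiset.map_nsmul, Multiset.map_nsmul,
      Multiset.sum_nsmul, Multiset.sum_nsmul, ← e, ← e', ← Nat.cast_smul_eq_nsmul ℚ,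
      ← Nat.cast_smul_eq_nsmul ℚ]
    push_cast
    module

lemma Good.smul {l h : ℤ} {E : ℤ × ℤ → ℚ} (hE : Good l h E) (r : ℚ) (hr : 0 ≤ r) :
    Good l h (r • E) := by
  obtain ⟨N, hN, M, hM, e⟩ := hE
  refine ⟨N * r.den, Nat.mul_pos hN r.pos, r.num.toNat • M,
    fun p hp => hM p (Multiset.mem_of_mem_nsmul hp), ?_⟩
  rw [Multiset.map_nsmul, Multiset.sum_nsmul, ← e, ← Nat.cast_smul_eq_nsmul ℚ, smul_smul,
    smul_smul]
  congr 1
  have h1 : ((r.num.toNat : ℕ) : ℚ) = (r.num : ℚ) := by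
    have := Int.toNat_of_nonneg (Rat.num_nonneg.2 hr)
    exact_mod_cast congrArg (Int.cast : ℤ → ℚ) this
  have h2 := Rat.den_mul_eq_num r
  rw [h1]; push_cast
  linear_combination (N : ℚ) * h2

lemma Good.sum {l h : ℤ} {n : ℕ} (F : Fin n → (ℤ × ℤ → ℚ)) (hF : ∀ k, Good l h (F k)) :
    Good l h (∑ k, F k) := by
  apply Finset.sum_induction F (Good l h) (fun _ _ => Good.add) (Good.zero l h)
  intro k _; exact hF k

lemma Good.pd {l h : ℤ} {p : ℤ × ℤ} (hp : Adm l h p) : Good l h (pd l h p) :=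
  ⟨1, one_pos, {p}, by simpa using hp, by simp⟩

lemma sum_pd (l h : ℤ) (M : Multiset (ℤ × ℤ)) : (M.map (pd l h)).sum =
    ((M.map Prod.fst).map (partA l h)).sum + ((M.map Prod.snd).map (partB l h)).sum := by
  rw [Multiset.map_map, Multiset.map_map, ← Multiset.sum_map_add]
  rfl

lemma good_term (D : ℤ × ℤ → ℚ) (l h : ℤ) (hl : ∀ j, D (0, j) ≠ 0 → j = l)
    (hh : ∀ j, D (3, j) ≠ 0 → j = h) (d : Fin (3 + 1) → ℤ) (P : ℤ × ℤ → ℚ)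
    (hP : IsPureDiagram 3 d P) (hnn : ∀ q, 0 ≤ P q) (a : ℚ) (ha : 0 ≤ a)
    (hle : ∀ q, a * P q ≤ D q) : Good l h (a • P) := by
  have hm := hP.strictMono
  have hx : d 0 < d 1 := hm (by decide)
  have hxy : d 1 < d 2 := hm (by decide)
  have hy : d 2 < d 3 := hm (by decide)
  have hx' : (0 : ℚ) < d 1 - d 0 := by rw [sub_pos]; exact_mod_cast hx
  have hxy' : (d 1 : ℚ) < d 2 := by exact_mod_cast hxy
  have hy' : (0 : ℚ) < d 3 - d 2 := by rw [sub_pos]; exact_mod_cast hy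
  have hxh : (0 : ℚ) < d 3 - d 1 := by linarith
  have hyl : (0 : ℚ) < d 2 - d 0 := by linarith
  have hdl : (0 : ℚ) < d 3 - d 0 := by linarith
  have he := pure_eq d P hP
  set s : ℚ := P (1, d 1) * (((d 1 : ℚ) - d 0) * (d 3 - d 1)) with hs
  have hs0 : 0 ≤ s := by have := hnn (1, d 1); positivity
  rcases ha.eq_or_lt with rfl | ha
  · rw [zero_smul]; exact Good.zero l h
  rcases hs0.eq_or_lt with hs0 | hs0
  · rw [he, ← hs0, zero_smul, smul_zero]; exact Good.zero l h
  have e0 : d 0 = l := by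
    apply hl
    have h1 := hle (0, d 0)
    have h2 : 0 < P (0, d 0) := by
      rw [he, Pi.smul_apply, smul_eq_mul, pd0]
      apply mul_pos hs0
      rw [sub_pos]
      apply one_div_lt_one_div_of_lt (by positivity)
      gcongr
    have := mul_pos ha h2
    linarith
  have e3 : d 3 = h := by
    apply hh
    have h1 := hle (3, d 3)
    have h2 : 0 < P (3, d 3) := by
      rw [he, Pi.smul_apply, smul_eq_mul, pd3]
      apply mul_pos hs0
      rw [sub_pos]
      apply one_div_lt_one_div_of_lt (by positivity)
      gcongr
    have := mul_pos ha h2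
    linarith
  apply Good.smul _ a ha.le
  rw [he]
  apply Good.smul _ s hs0.le
  rw [← e0, ← e3]
  exact Good.pd ⟨hx, hxy, hy⟩

end Stmt13Aux

/-- convexity of the order complex: a nonnegative linear combination of pure
diagrams of codimension `3` with a single nonzero entry in row `0` and in row `3` can be
written as a nonnegative linear combination of pure diagrams whose types form a chain. -/
theorem stmt13 (D : ℤ × ℤ → ℚ) (hD : IsNonnegCombPure 3 D)
    (h0 : ∃! j : ℤ, D (0, j) ≠ 0) (h3 : ∃! j : ℤ, D (3, j) ≠ 0) :
    ∃ (m : ℕ) (a : Fin m → ℚ) (P : Fin m → (ℤ × ℤ → ℚ)) (t : Fin m → (Fin (3 + 1) → ℤ)),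
      (∀ k, 0 ≤ a k) ∧ (∀ k, IsPureDiagram 3 (t k) (P k)) ∧ (∀ k q, 0 ≤ P k q) ∧
      D = ∑ k, a k • P k ∧
      ∀ k l, (∀ i, t k i ≤ t l i) ∨ (∀ i, t l i ≤ t k i) := by
  obtain ⟨l, -, hl⟩ := h0
  obtain ⟨h, -, hh⟩ := h3
  obtain ⟨n, a, P, t, ha, hP, hnn, hsum⟩ := hD
  have hgood : Stmt13Aux.Good l h D := by
    rw [hsum]
    apply Stmt13Aux.Good.sum
    intro k
    refine Stmt13Aux.good_term D l h hl hh (t k) (P k) (hP k) (hnn k) (a k) (ha k) ?_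
    intro q
    rw [hsum, Finset.sum_apply]
    exact Finset.single_le_sum (f := fun k => (a k • P k) q)
      (fun i _ => mul_nonneg (ha i) (hnn i q)) (Finset.mem_univ k)
  obtain ⟨N, hN, M, hM, e⟩ := hgood
  obtain ⟨M', h1, h2, h3, h4⟩ := Stmt13Aux.rearrange _ M rfl (fun p hp => (hM p hp).2.1)
  have hM' : ∀ p ∈ M', Stmt13Aux.Adm l h p := by
    intro p hp
    refine ⟨?_, h1 p hp, ?_⟩
    · have : p.1 ∈ M.map Prod.fst := h2 ▸ Multiset.mem_map_of_mem Prod.fst hp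
      obtain ⟨q, hq, hqe⟩ := Multiset.mem_map.1 this
      rw [← hqe]; exact (hM q hq).1
    · have : p.2 ∈ M.map Prod.snd := h3 ▸ Multiset.mem_map_of_mem Prod.snd hp
      obtain ⟨q, hq, hqe⟩ := Multiset.mem_map.1 this
      rw [← hqe]; exact (hM q hq).2.2
  rw [Stmt13Aux.sum_pd, ← h2, ← h3, ← Stmt13Aux.sum_pd] at e
  have hmem : ∀ k : Fin M'.toList.length, M'.toList.get k ∈ M' := fun k =>
    Multiset.mem_toList.1 (List.get_mem _ _)
  refine ⟨M'.toList.length, fun _ => (N : ℚ)⁻¹, fun k => Stmt13Aux.pd l h (M'.toList.get k),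
    fun k => Stmt13Aux.ty l h (M'.toList.get k), fun _ => by positivity,
    fun k => Stmt13Aux.pd_pure l h _ (hM' _ (hmem k)),
    fun k => Stmt13Aux.pd_nonneg l h _ (hM' _ (hmem k)), ?_, ?_⟩
  · rw [← Finset.smul_sum]
    have hS : ∑ k : Fin M'.toList.length, Stmt13Aux.pd l h (M'.toList.get k) =
        (M'.map (Stmt13Aux.pd l h)).sum := by
      conv_rhs => rw [← Multiset.coe_toList M']
      rw [Multiset.map_coe, Multiset.sum_coe, ← Fin.sum_univ_fun_getElem]
      rfl
    rw [hS, ← e, smul_smul, inv_mul_cancel₀ (by positivity), one_smul]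
  · intro k j
    have aux : ∀ p q : ℤ × ℤ, p ≤ q → ∀ i, Stmt13Aux.ty l h p i ≤ Stmt13Aux.ty l h q i := by
      intro p q hpq i
      fin_cases i
      · exact le_rfl
      · exact hpq.1
      · exact hpq.2
      · exact le_rfl
    exact (h4 _ (hmem k) _ (hmem j)).imp (aux _ _) (aux _ _)
end

section
/- Let q ≥ 0 and m be integers and let A be a diagram of codimension q. Define A′ : ℤ × ℤ → ℚ by A′ i j = A (q−i) (m−j). Then A′ is a diagram of codimension q; moreover, if A is a pure diagram of type (d_0, d_1, ..., d_q), then A′ is a pure diagram of type (m−d_q, m−d_{q−1}, ..., m−d_0). -/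
lemma SPoly_rot (q : ℕ) (m : ℤ) (A : ℤ × ℤ → ℚ) (hf : (Function.support A).Finite)
    (A' : ℤ × ℤ → ℚ) (hA' : ∀ i j : ℤ, A' (i, j) = A ((q : ℤ) - i, m - j)) :
    SPoly A' = (LaurentPolynomial.C ((-1 : ℚ) ^ q) * LaurentPolynomial.T m) *
      LaurentPolynomial.invert (SPoly A) := by
  unfold SPoly
  have hfin : (Function.support (fun p : ℤ × ℤ =>
      LaurentPolynomial.C ((-1 : ℚ) ^ p.1 * A p) * LaurentPolynomial.T p.2)).Finite := by
    refine hf.subset ?_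
    intro p hp h0
    apply hp
    simp [h0]
  have hmap := AddMonoidHom.map_finsum
    ((AddMonoidHom.mulLeft (LaurentPolynomial.C ((-1 : ℚ) ^ q) * LaurentPolynomial.T m)).comp
      ((LaurentPolynomial.invert (R := ℚ)).toAlgHom.toRingHom.toAddMonoidHom)) hfin
  refine Eq.trans ?_ hmap.symm
  let e : ℤ × ℤ ≃ ℤ × ℤ := (Equiv.subLeft (q : ℤ)).prodCongr (Equiv.subLeft m)
  refine finsum_eq_of_bijective e e.bijective ?_
  rintro ⟨i, j⟩
  have h1 : (-1 : ℚ) ^ q * (-1 : ℚ) ^ ((q : ℤ) - i) = (-1 : ℚ) ^ i := by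
    rw [zpow_sub₀ (by norm_num), zpow_natCast, ← mul_div_assoc, ← mul_pow]
    rcases Int.even_or_odd i with h | h
    · simp [h.neg_one_zpow]
    · simp [h.neg_one_zpow]
  change LaurentPolynomial.C ((-1 : ℚ) ^ i * A' (i, j)) * LaurentPolynomial.T j =
    (LaurentPolynomial.C ((-1 : ℚ) ^ q) * LaurentPolynomial.T m) * LaurentPolynomial.invert
     (LaurentPolynomial.C ((-1 : ℚ) ^ ((q : ℤ) - i) * A ((q : ℤ) - i, m - j)) *
        LaurentPolynomial.T (m - j))
  have h2 : (LaurentPolynomial.T j : LaurentPolynomial ℚ) =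
      LaurentPolynomial.T m * LaurentPolynomial.T (-(m - j)) := by
    rw [← LaurentPolynomial.T_add]; congr 1; ring
  rw [map_mul LaurentPolynomial.invert, LaurentPolynomial.invert_C, LaurentPolynomial.invert_T,
    hA', ← h1, h2]
  simp only [map_mul]
  ring

lemma isDiagram_rot (q : ℕ) (m : ℤ) (A : ℤ × ℤ → ℚ) (hA : IsDiagram q A)
    (A' : ℤ × ℤ → ℚ) (hA' : ∀ i j : ℤ, A' (i, j) = A ((q : ℤ) - i, m - j)) :
    IsDiagram q A' := by
  refine ⟨?_, ?_, ?_⟩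
  · let e : ℤ × ℤ ≃ ℤ × ℤ := (Equiv.subLeft (q : ℤ)).prodCongr (Equiv.subLeft m)
    refine (hA.finite.preimage (f := e) e.injective.injOn).subset ?_
    rintro ⟨i, j⟩ h
    have h' : A' (i, j) ≠ 0 := h
    rw [hA'] at h'
    exact h'
  · intro i j h
    rw [hA']
    exact hA.zero_outside _ _ (by omega)
  · rw [SPoly_rot q m A hA.finite A' hA']
    refine Dvd.dvd.mul_left ?_ _
    have h := map_dvd (LaurentPolynomial.invert (R := ℚ)) hA.dvd
    refine dvd_trans ?_ h
    rw [map_pow]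
    refine pow_dvd_pow_of_dvd ?_ q
    refine ⟨-LaurentPolynomial.T (-1), ?_⟩
    have h3 : (LaurentPolynomial.T 1 : LaurentPolynomial ℚ) * LaurentPolynomial.T (-1) = 1 := by
      rw [← LaurentPolynomial.T_add]; simp
    rw [map_sub, map_one, LaurentPolynomial.invert_T]
    linear_combination -h3

/-- the rotation `A′ i j = A (q−i) (m−j)` of a diagram of codimension `q` is a
diagram of codimension `q`, and it sends a pure diagram of type `(d₀,…,d_q)` to a pure
diagram of type `(m−d_q, …, m−d₀)`. -/
theorem stmt14 (q : ℕ) (m : ℤ) (A : ℤ × ℤ → ℚ) (hA : IsDiagram q A)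
    (A' : ℤ × ℤ → ℚ) (hA' : ∀ i j : ℤ, A' (i, j) = A ((q : ℤ) - i, m - j)) :
    IsDiagram q A' ∧
      ∀ d : Fin (q + 1) → ℤ, IsPureDiagram q d A →
        IsPureDiagram q (fun k => m - d (Fin.rev k)) A' := by
  refine ⟨isDiagram_rot q m A hA A' hA', fun d hd => ⟨isDiagram_rot q m A hA A' hA', ?_, ?_⟩⟩
  · intro a b hab
    have := hd.strictMono (Fin.rev_lt_rev.mpr hab)
    change m - d (Fin.rev a) < m - d (Fin.rev b)
    omega
  · intro k j hj
    rw [hA']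
    have h := hd.pure (Fin.rev k) (m - j) (by intro h; apply hj; show j = m - d (Fin.rev k); omega)
    have hk : (((Fin.rev k : Fin (q + 1)) : ℕ) : ℤ) = (q : ℤ) - ((k : ℕ) : ℤ) := by
      have := k.isLt
      rw [Fin.val_rev]; omega
    rwa [hk] at h
end

section
/- Let p ≥ 2, c ≥ 0 and 0 ≤ j ≤ c be integers and let D be a normalized pure diagram of codimension p of type (0, j+1, j+2, ..., j+p−1, c+p) (so D 0 0 = 1). Then S_D(t) = (1−t)^p · h(t) in ℚ[t,t⁻¹], where h(t) = Σ_{i=0}^{j} r_i t^i + (r_j / r_{c−j}) · Σ_{i=j+1}^{c} r_{c−i} t^i and r_i = binomial(p-1+i, p-1). -/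
noncomputable def momL (q : Polynomial ℚ) (F : LaurentPolynomial ℚ) : ℚ :=
  F.coeff.sum fun n a => a * q.eval (n : ℚ)

lemma momL_add (q : Polynomial ℚ) (F G : LaurentPolynomial ℚ) :
    momL q (F + G) = momL q F + momL q G := by
  unfold momL
  rw [AddMonoidAlgebra.coeff_add]
  exact Finsupp.sum_add_index' (by simp) (by intros; ring)

lemma momL_single (q : Polynomial ℚ) (n : ℤ) (a : ℚ) :
    momL q (LaurentPolynomial.C a * LaurentPolynomial.T n) = a * q.eval (n : ℚ) := by
  unfold momL
  rw [← LaurentPolynomial.single_eq_C_mul_T, AddMonoidAlgebra.coeff_single]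
  exact Finsupp.sum_single_index (by simp)

lemma momL_mul (q : Polynomial ℚ) (F : LaurentPolynomial ℚ) :
    momL q ((1 - LaurentPolynomial.T 1) * F) = momL (q - Polynomial.taylor 1 q) F := by
  have key : momL q F = momL q ((1 - LaurentPolynomial.T 1) * F)
      + momL q (LaurentPolynomial.T 1 * F) := by
    rw [← momL_add]; congr 1; ring
  have h2 : momL q (LaurentPolynomial.T 1 * F) = momL (Polynomial.taylor 1 q) F := by
    induction F using LaurentPolynomial.induction_on' with
    | add f g hf hg =>
      have e : ∀ f : LaurentPolynomial ℚ, momL q f = momL q ((1 - LaurentPolynomial.T 1) * f)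
          + momL q (LaurentPolynomial.T 1 * f) := by
        intro f
        rw [← momL_add]; congr 1; ring
      rw [mul_add, momL_add, momL_add, hf (e f), hg (e g)]
    | C_mul_T n a =>
      have : (LaurentPolynomial.T 1 * (LaurentPolynomial.C a * LaurentPolynomial.T n) :
          LaurentPolynomial ℚ) = LaurentPolynomial.C a * LaurentPolynomial.T (n + 1) := by
        rw [LaurentPolynomial.T_add]; ring
      rw [this, momL_single, momL_single, Polynomial.taylor_eval]
      push_cast; rfl
  have h3 : momL (q - Polynomial.taylor 1 q) F = momL q F - momL (Polynomial.taylor 1 q) F := by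
    unfold momL Finsupp.sum
    rw [← Finset.sum_sub_distrib]
    refine Finset.sum_congr rfl fun n _ => ?_
    simp only [Polynomial.eval_sub]; ring
  rw [h3, key, h2]; ring

lemma momL_pow (p : ℕ) (q : Polynomial ℚ) (hq : q.degree < p) (G : LaurentPolynomial ℚ) :
    momL q ((1 - LaurentPolynomial.T 1) ^ p * G) = 0 := by
  induction p generalizing q with
  | zero =>
    have : q = 0 := by
      rw [← Polynomial.degree_eq_bot]
      simpa using hq
    simp [this, momL]
  | succ p ih =>
    rw [pow_succ', mul_assoc, momL_mul]
    apply ih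
    by_cases h0 : q = 0
    · simp [h0]
    have h1 : (q - Polynomial.taylor 1 q).degree < q.degree :=
      Polynomial.degree_sub_lt (Polynomial.degree_taylor q 1).symm h0
        (Polynomial.leadingCoeff_taylor 1 q).symm
    rw [Polynomial.degree_eq_natDegree h0] at h1 hq
    refine lt_of_lt_of_le h1 ?_
    have : q.natDegree < p + 1 := by exact_mod_cast hq
    exact_mod_cast Nat.lt_succ_iff.mp this

lemma eq_zero_of_few (p : ℕ) (A : Finset ℤ) (hA : A.card ≤ p) (F : LaurentPolynomial ℚ)
    (hd : (1 - LaurentPolynomial.T 1) ^ p ∣ F) (hF : ∀ n ∉ A, F.coeff n = 0) : F = 0 := by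
  apply LaurentPolynomial.ext
  intro a
  by_cases ha : a ∈ A
  swap
  · simpa using hF a ha
  obtain ⟨G, hG⟩ := hd
  let q : Polynomial ℚ := ∏ b ∈ A.erase a, (Polynomial.X - Polynomial.C (b : ℚ))
  have hq : q.degree < p := by
    have : q.degree = ((A.erase a).card : ℕ) := by
      simp only [q]
      rw [Polynomial.degree_prod]
      simp only [Polynomial.degree_X_sub_C]
      simp
    rw [this, Finset.card_erase_of_mem ha]
    have := Finset.card_pos.mpr ⟨a, ha⟩
    exact_mod_cast (by omega : A.card - 1 < p)
  have h := momL_pow p q hq G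
  rw [← hG] at h
  unfold momL at h
  rw [Finsupp.sum, Finset.sum_eq_single a] at h
  · rcases mul_eq_zero.mp h with h | h
    · simpa using h
    · exfalso
      simp only [q, Polynomial.eval_prod, Finset.prod_eq_zero_iff] at h
      obtain ⟨b, hb, hb'⟩ := h
      simp [sub_eq_zero] at hb'
      exact (Finset.ne_of_mem_erase hb) hb'.symm
  · intro b hb hba
    by_cases hbA : b ∈ A
    · have : q.eval (b : ℚ) = 0 := by
        simp only [q, Polynomial.eval_prod]
        apply Finset.prod_eq_zero (Finset.mem_erase.mpr ⟨hba, hbA⟩)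
        simp
      rw [this, mul_zero]
    · rw [hF b hbA, zero_mul]
  · intro hn
    rw [Finsupp.notMem_support_iff.mp hn, zero_mul]

def bdiff (f : ℤ → ℚ) : ℤ → ℚ := fun i => f i - f (i - 1)

lemma coeff_pow_mul (p : ℕ) (F : LaurentPolynomial ℚ) (i : ℤ) :
    ((1 - LaurentPolynomial.T 1) ^ p * F).coeff i = (bdiff^[p] (fun n => F.coeff n)) i := by
  induction p generalizing F with
  | zero => simp
  | succ p ih =>
    rw [pow_succ, mul_assoc, ih, Function.iterate_succ_apply]
    refine congrFun (congrArg (bdiff^[p]) (funext fun n => ?_)) i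
    have h : (LaurentPolynomial.T 1 * F).coeff n = F.coeff (n - 1) := by
      have := AddMonoidAlgebra.coeff_single_mul_add F (1 : ℚ) (1 : ℤ) (n - 1)
      rw [one_mul, add_sub_cancel] at this
      exact this
    rw [sub_mul, one_mul, AddMonoidAlgebra.coeff_sub, Finsupp.sub_apply, h]
    rfl

lemma bdiff_local (p : ℕ) (f g : ℤ → ℚ) (i : ℤ) (h : ∀ n, i - p ≤ n → n ≤ i → f n = g n) :
    (bdiff^[p] f) i = (bdiff^[p] g) i := by
  induction p generalizing f g with
  | zero => exact h i (by simp) le_rfl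
  | succ p ih =>
    rw [Function.iterate_succ_apply, Function.iterate_succ_apply]
    apply ih
    intro n h1 h2
    push_cast at h
    unfold bdiff
    rw [h n (by omega) h2, h (n - 1) (by omega) (by omega)]

lemma bdiff_refl (p : ℕ) (K : ℚ) (c : ℤ) (g : ℤ → ℚ) (i : ℤ) :
    (bdiff^[p] (fun n => K * g (c - n))) i = (-1) ^ p * K * (bdiff^[p] g) (c + p - i) := by
  induction p generalizing K c g with
  | zero => simp
  | succ p ih =>
    rw [Function.iterate_succ_apply, Function.iterate_succ_apply]
    have : bdiff (fun n => K * g (c - n)) = fun n => (-K) * (bdiff g) ((c + 1) - n) := by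
      funext n
      simp only [bdiff]
      rw [show c + 1 - n - 1 = c - n by ring, show c - (n - 1) = c + 1 - n by ring]
      ring
    rw [this, ih]
    push_cast
    rw [show c + 1 + (p : ℤ) - i = c + (p + 1) - i by ring]
    ring

lemma bdiff_rr_succ (p : ℕ) : bdiff (rr (p + 2)) = rr (p + 1) := by
  funext i
  unfold bdiff rr
  rcases lt_trichotomy i 0 with h | h | h
  · rw [if_pos h, if_pos (by omega), if_pos h]; ring
  · subst h; simp
  · obtain ⟨m, rfl⟩ : ∃ m : ℕ, i = m + 1 := ⟨(i - 1).toNat, by omega⟩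
    rw [if_neg (by omega), if_neg (by omega), if_neg (by omega)]
    have e1 : ((m : ℤ) + 1).toNat = m + 1 := by omega
    have e2 : ((m : ℤ) + 1 - 1).toNat = m := by omega
    rw [e1, e2]
    simp only [Nat.add_sub_cancel, show p + 2 - 1 = p + 1 by omega]
    have : Nat.choose (p + 1 + (m + 1)) (p + 1)
        = Nat.choose (p + (m + 1)) p + Nat.choose (p + 1 + m) (p + 1) := by
      rw [show p + 1 + (m + 1) = (p + 1 + m) + 1 by ring, Nat.choose_succ_succ,
        show p + (m + 1) = p + 1 + m by ring]
    rw [this]; push_cast; ring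

lemma bdiff_rr (p : ℕ) (i : ℤ) : (bdiff^[p + 1] (rr (p + 1))) i = if i = 0 then 1 else 0 := by
  induction p with
  | zero =>
    simp only [zero_add, Function.iterate_one, bdiff, rr]
    rcases lt_trichotomy i 0 with h | h | h
    · rw [if_pos h, if_pos (by omega), if_neg (by omega)]; ring
    · subst h; simp
    · rw [if_neg (by omega), if_neg (by omega), if_neg (by omega)]; simp
  | succ p ih => rw [Function.iterate_succ_apply, bdiff_rr_succ, ih]

lemma rr_ne_zero (p : ℕ) (i : ℤ) (hi : 0 ≤ i) : rr p i ≠ 0 := by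
  unfold rr
  rw [if_neg (by omega)]
  exact_mod_cast (Nat.choose_pos (by omega)).ne'

lemma hpi_low (p c j : ℕ) (i : ℤ) (h : i ≤ j) : hpi p c j i = rr p i := by
  unfold hpi
  by_cases h0 : 0 ≤ i
  · rw [if_pos ⟨h0, h⟩]
  · rw [if_neg (by omega), if_neg (by omega)]; unfold rr; rw [if_pos (by omega)]

lemma hpi_high (p c j : ℕ) (hj : j ≤ c) (i : ℤ) (h : j ≤ i) :
    hpi p c j i = rr p (j : ℤ) / rr p ((c : ℤ) - (j : ℤ)) * rr p ((c : ℤ) - i) := by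
  rcases h.eq_or_lt with h | h
  · subst h
    rw [hpi_low _ _ _ _ le_rfl, div_mul_cancel₀]
    exact rr_ne_zero _ _ (by omega)
  · unfold hpi
    rw [if_neg (by omega)]
    by_cases hc : i ≤ c
    · rw [if_pos ⟨h, hc⟩]
    · rw [if_neg (by omega)]
      have : rr p ((c : ℤ) - i) = 0 := by unfold rr; rw [if_pos (by omega)]
      rw [this, mul_zero]

lemma coeff_term (a : ℚ) (m n : ℤ) :
    (LaurentPolynomial.C a * LaurentPolynomial.T m).coeff n = if m = n then a else 0 := by
  rw [← LaurentPolynomial.single_eq_C_mul_T, AddMonoidAlgebra.coeff_single,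
    Finsupp.single_apply]

lemma coeff_rowPoly (h : ℤ → ℚ) (hf : (Function.support h).Finite) (n : ℤ) :
    (rowPoly h).coeff n = h n := by
  unfold rowPoly
  rw [finsum_eq_sum_of_support_subset (s := hf.toFinset)]
  · rw [AddMonoidAlgebra.coeff_sum, Finsupp.finsetSum_apply]
    simp only [coeff_term]
    rw [Finset.sum_ite_eq']
    split_ifs with hn
    · rfl
    · simp at hn; exact hn.symm
  · intro x hx
    simp only [Set.Finite.coe_toFinset, Function.mem_support] at hx ⊢
    intro h0; apply hx; simp [h0]

lemma coeff_SPoly (D : ℤ × ℤ → ℚ) (hf : (Function.support D).Finite) (n : ℤ) :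
    (SPoly D).coeff n = ∑ q ∈ hf.toFinset, if q.2 = n then (-1 : ℚ) ^ q.1 * D q else 0 := by
  unfold SPoly
  rw [finsum_eq_sum_of_support_subset (s := hf.toFinset)]
  · rw [AddMonoidAlgebra.coeff_sum, Finsupp.finsetSum_apply]
    simp only [coeff_term]
  · intro x hx
    simp only [Set.Finite.coe_toFinset, Function.mem_support] at hx ⊢
    intro h0; apply hx; simp [h0]

lemma pure_mem (p : ℕ) (d : Fin (p + 1) → ℤ) (D : ℤ × ℤ → ℚ) (hD : IsPureDiagram p d D)
    (q : ℤ × ℤ) (hq : D q ≠ 0) : ∃ k : Fin (p + 1), q = (((k : ℕ) : ℤ), d k) := by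
  obtain ⟨a, b⟩ := q
  have h1 : 0 ≤ a ∧ a ≤ p := by
    by_contra hcon
    exact hq (hD.diagram.zero_outside a b (by omega))
  refine ⟨⟨a.toNat, by omega⟩, ?_⟩
  have ha : ((a.toNat : ℕ) : ℤ) = a := by omega
  by_contra hne
  apply hq
  have := hD.pure ⟨a.toNat, by omega⟩ b (by
    intro hb; apply hne; simp only [ha]; rw [← hb])
  simpa only [ha] using this

/-- the h-vector of the normalized extremely compressed pure diagram of type
`(0, j+1, …, j+p−1, c+p)` is `Σ_{i=0}^j r_i t^i + (r_j/r_{c−j}) Σ_{i=j+1}^c r_{c−i} t^i`. -/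
theorem stmt15 (p c j : ℕ) (hp : 2 ≤ p) (hj : j ≤ c) (D : ℤ × ℤ → ℚ)
    (hD : IsPureDiagram p (midType p 0 (j : ℤ) ((c : ℤ) + (p : ℤ))) D)
    (hnorm : D (0, 0) = 1) :
    SPoly D = (1 - LaurentPolynomial.T 1) ^ p * rowPoly (hpi p c j) := by
  have hfin := hD.diagram.finite
  have hS0 : (SPoly D).coeff 0 = 1 := by
    rw [coeff_SPoly D hfin, Finset.sum_eq_single ((0, 0) : ℤ × ℤ)]
    · simp [hnorm]
    · intro q hq hne
      rw [if_neg]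
      intro h0
      obtain ⟨k, rfl⟩ := pure_mem p _ D hD q (by simpa using hq)
      simp only [midType] at h0 hne
      split_ifs at h0 hne with h1 h2
      · exact hne (by simp [h1])
      · omega
      · omega
    · intro h
      simp [hnorm] at h
  have hSn : ∀ n : ℤ, n ≠ 0 → n ∉ Finset.Icc ((j : ℤ) + 1) (j + p - 1) → n ≠ c + p →
      (SPoly D).coeff n = 0 := by
    intro n h0 h1 h2
    rw [coeff_SPoly D hfin]
    apply Finset.sum_eq_zero
    intro q hq
    rw [if_neg]
    intro hn
    obtain ⟨k, rfl⟩ := pure_mem p _ D hD q (by simpa using hq)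
    have hk := k.2
    rw [Finset.mem_Icc] at h1
    simp only [midType] at hn
    split_ifs at hn with h3 h4 <;> omega
  have hhfin : (Function.support (hpi p c j)).Finite := by
    apply (Set.finite_Icc (0 : ℤ) c).subset
    intro i hi
    by_contra hcon
    rw [Set.mem_Icc] at hcon
    apply hi
    unfold hpi
    rw [if_neg (by omega), if_neg (by omega)]
  have hQ : ∀ n, ((1 - LaurentPolynomial.T 1) ^ p * rowPoly (hpi p c j)).coeff n
      = (bdiff^[p] (hpi p c j)) n := by
    intro n
    rw [coeff_pow_mul]
    exact congrFun (congrArg (bdiff^[p]) (funext fun m => coeff_rowPoly _ hhfin m)) n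
  have hrr : ∀ i : ℤ, (bdiff^[p] (rr p)) i = if i = 0 then 1 else 0 := by
    obtain ⟨p, rfl⟩ : ∃ m, p = m + 1 := ⟨p - 1, by omega⟩
    exact bdiff_rr p
  have hlow : ∀ n : ℤ, n ≤ j → (bdiff^[p] (hpi p c j)) n = if n = 0 then 1 else 0 := by
    intro n hn
    rw [← hrr]
    exact bdiff_local p _ _ n fun m _ h2 => hpi_low p c j m (by omega)
  have hhigh : ∀ n : ℤ, (j : ℤ) + p ≤ n → n ≠ c + p → (bdiff^[p] (hpi p c j)) n = 0 := by
    intro n hn hne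
    rw [bdiff_local p _ _ n fun m h1 _ => hpi_high p c j hj m (by omega), bdiff_refl, hrr,
      if_neg (by omega), mul_zero]
  rw [← sub_eq_zero]
  apply eq_zero_of_few p (insert ((c : ℤ) + p) (Finset.Icc ((j : ℤ) + 1) (j + p - 1)))
  · refine (Finset.card_insert_le _ _).trans ?_
    rw [Int.card_Icc]
    omega
  · exact dvd_sub hD.diagram.dvd (dvd_mul_right _ _)
  · intro n hn
    rw [Finset.mem_insert, not_or] at hn
    rw [AddMonoidAlgebra.coeff_sub, Finsupp.sub_apply, hQ]
    by_cases h0 : n = 0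
    · subst h0
      rw [hS0, hlow 0 (by omega)]; simp
    · rw [hSn n h0 hn.2 hn.1]
      have h2 := hn.2
      rw [Finset.mem_Icc] at h2
      by_cases h1 : n ≤ j
      · rw [hlow n h1, if_neg h0, sub_zero]
      · rw [hhigh n (by omega) hn.1, sub_zero]
end

section
/- Let p ≥ 1 and let 0 < d_1 < d_2 < ... < d_p be integers, and let D be a normalized pure diagram of codimension p of type (0, d_1, ..., d_p) (so D 0 0 = 1). Then e(D) = (d_1 · d_2 · ⋯ · d_p) / p!. -/
/-- The functional sending `Σ a_j t^j` to `Σ a_j g(j)`. -/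
noncomputable def Lfun (g : ℚ → ℚ) : LaurentPolynomial ℚ →ₗ[ℚ] ℚ :=
  (Finsupp.linearCombination ℚ (fun j : ℤ => g (j : ℚ))) ∘ₗ
    (AddMonoidAlgebra.coeffLinearEquiv ℚ).toLinearMap

theorem Lfun_C_mul_T (g : ℚ → ℚ) (a : ℚ) (n : ℤ) :
    Lfun g (LaurentPolynomial.C a * LaurentPolynomial.T n) = a * g n := by
  rw [← LaurentPolynomial.single_eq_C_mul_T]
  change Finsupp.linearCombination ℚ (fun j : ℤ => g (j : ℚ)) (Finsupp.single n a) = _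
  rw [Finsupp.linearCombination_single, smul_eq_mul]

theorem Lfun_mul (g : ℚ → ℚ) (f : LaurentPolynomial ℚ) :
    Lfun g ((1 - LaurentPolynomial.T 1) * f) = - Lfun (fwdDiff 1 g) f := by
  induction f using LaurentPolynomial.induction_on' with
  | add p q hp hq => rw [mul_add, map_add, map_add, hp, hq]; ring
  | C_mul_T n a =>
    have : (1 - LaurentPolynomial.T 1) * (LaurentPolynomial.C a * LaurentPolynomial.T n)
      = LaurentPolynomial.C a * LaurentPolynomial.T n
        - LaurentPolynomial.C a * LaurentPolynomial.T (n + 1) := by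
      rw [LaurentPolynomial.T_add]; ring
    rw [this, map_sub, Lfun_C_mul_T, Lfun_C_mul_T, Lfun_C_mul_T, fwdDiff]
    push_cast
    ring

theorem Lfun_pow_mul (p : ℕ) (g : ℚ → ℚ) (f : LaurentPolynomial ℚ) :
    Lfun g ((1 - LaurentPolynomial.T 1) ^ p * f) = (-1) ^ p * Lfun ((fwdDiff 1)^[p] g) f := by
  induction p generalizing g with
  | zero => simp
  | succ n ih =>
    rw [pow_succ', mul_assoc, Lfun_mul, ih, Function.iterate_succ_apply]
    ring

theorem Lfun_rowPoly (g : ℚ → ℚ) (h : ℤ → ℚ) (hfin : (Function.support h).Finite) :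
    Lfun g (rowPoly h) = ∑ᶠ j : ℤ, h j * g j := by
  unfold rowPoly
  have := (Lfun g).toAddMonoidHom.map_finsum
    (f := fun j : ℤ => LaurentPolynomial.C (h j) * LaurentPolynomial.T j)
    (hfin.subset (fun x hx hx' => hx (by simp [hx'])))
  refine this.trans (finsum_congr fun j => Lfun_C_mul_T g (h j) j)

theorem Lfun_SPoly (g : ℚ → ℚ) (D : ℤ × ℤ → ℚ) (hfin : (Function.support D).Finite) :
    Lfun g (SPoly D) = ∑ᶠ q : ℤ × ℤ, ((-1 : ℚ) ^ q.1 * D q) * g q.2 := by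
  unfold SPoly
  have := (Lfun g).toAddMonoidHom.map_finsum
    (f := fun q : ℤ × ℤ => LaurentPolynomial.C ((-1 : ℚ) ^ q.1 * D q) * LaurentPolynomial.T q.2)
    (hfin.subset (fun x hx hx' => hx (by simp [hx'])))
  refine this.trans (finsum_congr fun j => Lfun_C_mul_T g _ _)

/-- the multiplicity of a normalized pure diagram of type `(0, d₁, …, dₚ)`
is `d₁·d₂ ⋯ dₚ / p!`. -/
theorem stmt16 (p : ℕ) (hp : 1 ≤ p) (d : Fin (p + 1) → ℤ) (hd0 : d 0 = 0)
    (D : ℤ × ℤ → ℚ) (hD : IsPureDiagram p d D) (hnorm : D (0, d 0) = 1)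
    (h : ℤ → ℚ) (hfin : (Function.support h).Finite)
    (hS : SPoly D = (1 - LaurentPolynomial.T 1) ^ p * rowPoly h) :
    ∑ᶠ i : ℤ, h i = (∏ i : Fin p, ((d i.succ : ℚ))) / (Nat.factorial p : ℚ) := by
  let P : Polynomial ℚ := ∏ i : Fin p, (Polynomial.X - Polynomial.C (d i.succ : ℚ))
  have hmonic : P.leadingCoeff = 1 :=
    Polynomial.monic_prod_of_monic _ _ fun i _ => Polynomial.monic_X_sub_C _
  have hdeg : P.natDegree = p := by
    rw [Polynomial.natDegree_finsetProd_X_sub_C_eq_card, Finset.card_univ, Fintype.card_fin]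
  have heval : ∀ x : ℚ, P.eval x = ∏ i : Fin p, (x - (d i.succ : ℚ)) := by
    intro x
    simp [P, Polynomial.eval_prod]
  have hdiff := P.fwdDiff_iter_degree_eq_factorial
  rw [hdeg, hmonic, one_smul] at hdiff
  have key := congrArg (Lfun (fun x => P.eval x)) hS
  rw [Lfun_pow_mul, hdiff, Lfun_rowPoly _ _ hfin, Lfun_SPoly _ _ hD.diagram.finite,
    finsum_eq_single _ ((0 : ℤ), (0 : ℤ))] at key
  · have h0 : D (0, 0) = 1 := by rw [← hnorm, hd0]
    simp only [h0, heval, Pi.natCast_apply] at key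
    rw [← finsum_mul] at key
    simp only [zpow_zero, Int.cast_zero, zero_sub, one_mul, Finset.prod_neg, Finset.card_univ,
      Fintype.card_fin] at key
    have hne : ((-1 : ℚ)) ^ p ≠ 0 := by simp
    rw [eq_div_iff (by positivity)]
    exact (mul_left_cancel₀ hne key).symm
  · rintro ⟨i, j⟩ hij
    by_cases hDz : D (i, j) = 0
    · simp [hDz]
    have hi : 0 ≤ i ∧ i ≤ p := by
      by_contra hcon
      exact hDz (hD.diagram.zero_outside i j (by omega))
    obtain ⟨k, rfl⟩ := Int.eq_ofNat_of_zero_le hi.1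
    have hk : k < p + 1 := by omega
    have hj : j = d ⟨k, hk⟩ := by
      by_contra hcon
      exact hDz (hD.pure ⟨k, hk⟩ j hcon)
    rcases k with _ | k
    · exact absurd (by rw [hj]; simpa using hd0) hij
    · have hz : P.eval (j : ℚ) = 0 := by
        rw [heval]
        refine Finset.prod_eq_zero (Finset.mem_univ (⟨k, by omega⟩ : Fin p)) ?_
        rw [hj]
        simp
      simp [hz]
end

section
/- Let p ≥ 1 and let 0 < d_1 < d_2 < ... < d_p be integers. Suppose D = Σ_k a_k π_k is a finite sum where each a_k is a nonnegative rational and each π_k is a normalized pure diagram of codimension p with nonnegative entries whose type (0, d_1^{(k)}, ..., d_p^{(k)}) satisfies d_i^{(k)} ≤ d_i for all 1 ≤ i ≤ p. Then e(D) ≤ (D 0 0) · (d_1 · d_2 · ⋯ · d_p) / p!. -/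
/-- The functional `f ↦ Σ_j f_j q(j)` on Laurent polynomials. -/
noncomputable def LL (q : ℤ → ℚ) : LaurentPolynomial ℚ →+ ℚ where
  toFun f := Finsupp.linearCombination ℚ q f.coeff
  map_zero' := by simp
  map_add' f g := by simp

lemma LL_CT (q : ℤ → ℚ) (a : ℚ) (n : ℤ) :
    LL q (LaurentPolynomial.C a * LaurentPolynomial.T n) = a * q n := by
  rw [← LaurentPolynomial.single_eq_C_mul_T]
  change Finsupp.linearCombination ℚ q (Finsupp.single n a) = _
  rw [Finsupp.linearCombination_single, smul_eq_mul]

lemma LL_one_sub_mul (q : ℤ → ℚ) (f : LaurentPolynomial ℚ) :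
    LL q ((1 - LaurentPolynomial.T 1) * f) = - LL (fwdDiff 1 q) f := by
  induction f using LaurentPolynomial.induction_on' with
  | add f g hf hg => rw [mul_add, map_add, hf, hg, map_add]; ring
  | C_mul_T n a =>
    have : (1 - LaurentPolynomial.T 1) * (LaurentPolynomial.C a * LaurentPolynomial.T n)
      = LaurentPolynomial.C a * LaurentPolynomial.T n
        - LaurentPolynomial.C a * LaurentPolynomial.T (n + 1) := by
      rw [LaurentPolynomial.T_add]; ring
    rw [this, map_sub, LL_CT, LL_CT, LL_CT, fwdDiff]; ring

lemma LL_pow_mul (p : ℕ) (q : ℤ → ℚ) (f : LaurentPolynomial ℚ) :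
    LL q ((1 - LaurentPolynomial.T 1) ^ p * f) = (-1) ^ p * LL ((fwdDiff 1)^[p] q) f := by
  induction p generalizing q with
  | zero => simp
  | succ p ih =>
    rw [pow_succ', mul_assoc, LL_one_sub_mul, ih, Function.iterate_succ_apply]; ring

lemma fwdDiff_int (p : ℕ) (g : ℚ → ℚ) :
    (fwdDiff 1)^[p] (fun n : ℤ => g n) = fun n : ℤ => (fwdDiff 1)^[p] g (n : ℚ) := by
  induction p generalizing g with
  | zero => rfl
  | succ p ih =>
    rw [Function.iterate_succ_apply, Function.iterate_succ_apply, ← ih]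
    congr 1
    funext n
    simp [fwdDiff]

lemma LL_monic (p : ℕ) (Q : Polynomial ℚ) (hQ : Q.Monic) (hdeg : Q.natDegree = p)
    (f : LaurentPolynomial ℚ) :
    LL (fun n : ℤ => Q.eval (n : ℚ)) ((1 - LaurentPolynomial.T 1) ^ p * f)
      = (-1) ^ p * (p.factorial * LL (fun _ => 1) f) := by
  have h1 := Polynomial.fwdDiff_iter_degree_eq_factorial Q
  rw [hdeg, hQ.leadingCoeff, one_smul] at h1
  rw [LL_pow_mul, fwdDiff_int p (fun x => Q.eval x), h1]
  congr 1
  induction f using LaurentPolynomial.induction_on' with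
  | add f g hf hg => rw [map_add, hf, hg, map_add]; ring
  | C_mul_T n a => rw [LL_CT, LL_CT]; simp [mul_comm]

lemma LL_SPoly (q : ℤ → ℚ) (D : ℤ × ℤ → ℚ) (s : Finset (ℤ × ℤ))
    (hs : Function.support D ⊆ s) :
    LL q (SPoly D) = ∑ x ∈ s, (-1 : ℚ) ^ x.1 * D x * q x.2 := by
  rw [SPoly, finsum_eq_sum_of_support_subset (s := s), map_sum]
  · simp only [LL_CT]
  · refine subset_trans ?_ hs
    intro x hx h0
    apply hx
    simp [h0]

lemma LL_rowPoly (h : ℤ → ℚ) (hfin : (Function.support h).Finite) :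
    LL (fun _ => 1) (rowPoly h) = ∑ᶠ i : ℤ, h i := by
  rw [rowPoly, finsum_eq_sum_of_support_subset (s := hfin.toFinset), map_sum,
    finsum_eq_sum_of_support_subset (s := hfin.toFinset)]
  · simp only [LL_CT, mul_one]
  · simp
  · intro x hx
    simp only [Set.Finite.coe_toFinset]
    intro h0
    apply hx
    simp [h0]

lemma pure_mult (p : ℕ) (t : Fin (p + 1) → ℤ) (D : ℤ × ℤ → ℚ) (hD : IsPureDiagram p t D)
    (ht0 : t 0 = 0) (hn : D (0, 0) = 1) (Q : Polynomial ℚ) (hQ : Q.Monic)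
    (hdeg : Q.natDegree = p) :
    LL (fun n : ℤ => Q.eval (n : ℚ)) (SPoly D) = (-1) ^ p * ∏ i : Fin p, (t i.succ : ℚ) := by
  obtain ⟨g, hg⟩ := hD.diagram.dvd
  set R : Polynomial ℚ := ∏ i : Fin p, (Polynomial.X - Polynomial.C (t i.succ : ℚ)) with hR
  have hRm : R.Monic := Polynomial.monic_prod_of_monic _ _ fun i _ => Polynomial.monic_X_sub_C _
  have hRd : R.natDegree = p := by
    rw [hR, Polynomial.natDegree_prod_of_monic _ _ fun i _ => Polynomial.monic_X_sub_C _]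
    simp only [Polynomial.natDegree_X_sub_C]
    simp
  have key : LL (fun n : ℤ => Q.eval (n : ℚ)) (SPoly D)
      = LL (fun n : ℤ => R.eval (n : ℚ)) (SPoly D) := by
    rw [hg, LL_monic p Q hQ hdeg, LL_monic p R hRm hRd]
  rw [key, LL_SPoly _ D hD.diagram.finite.toFinset (by simp), Finset.sum_eq_single (0, 0)]
  · simp [hn, hR, Polynomial.eval_prod, Finset.prod_neg]
  · rintro ⟨i, j⟩ - hij
    by_cases hi : i < 0 ∨ (p : ℤ) < i
    · rw [hD.diagram.zero_outside i j hi]; simp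
    · push Not at hi
      obtain ⟨k, hk⟩ : ∃ k : Fin (p + 1), ((k : ℕ) : ℤ) = i :=
        ⟨⟨i.toNat, by omega⟩, by simp [hi.1]⟩
      by_cases hj : j = t k
      · rcases Fin.eq_zero_or_eq_succ k with rfl | ⟨k, rfl⟩
        · exfalso
          apply hij
          rw [hj, ht0, ← hk]; simp
        · have : R.eval (j : ℚ) = 0 := by
            rw [hR, Polynomial.eval_prod]
            exact Finset.prod_eq_zero (Finset.mem_univ k) (by simp [hj])
          simp [this]
      · rw [← hk, hD.pure k j hj]; simp
  · intro h0
    exfalso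
    apply h0
    simp [hn]

/-- a nonnegative linear combination of normalized pure diagrams whose types
are bounded above by `(0, d₁, …, dₚ)` has multiplicity at most `D₀₀ · d₁·d₂ ⋯ dₚ / p!`. -/
theorem stmt17 (p : ℕ) (hp : 1 ≤ p) (d : Fin (p + 1) → ℤ) (hd0 : d 0 = 0)
    (hdmono : StrictMono d)
    (n : ℕ) (a : Fin n → ℚ) (P : Fin n → (ℤ × ℤ → ℚ)) (t : Fin n → (Fin (p + 1) → ℤ))
    (ha : ∀ k, 0 ≤ a k)
    (hP : ∀ k, IsPureDiagram p (t k) (P k))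
    (ht0 : ∀ k, t k 0 = 0)
    (hPnorm : ∀ k, P k (0, 0) = 1)
    (hPnn : ∀ k q, 0 ≤ P k q)
    (htle : ∀ k i, t k i ≤ d i)
    (D : ℤ × ℤ → ℚ) (hDsum : D = ∑ k, a k • P k)
    (h : ℤ → ℚ) (hfin : (Function.support h).Finite)
    (hS : SPoly D = (1 - LaurentPolynomial.T 1) ^ p * rowPoly h) :
    ∑ᶠ i : ℤ, h i ≤ D (0, 0) * ((∏ i : Fin p, ((d i.succ : ℚ))) / (Nat.factorial p : ℚ)) := by
  have hX := Polynomial.natDegree_X_pow (R := ℚ) p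
  have hXm := Polynomial.monic_X_pow (R := ℚ) p
  set Q : Polynomial ℚ := Polynomial.X ^ p
  set q : ℤ → ℚ := fun n : ℤ => Q.eval (n : ℚ) with hq
  have e1 : LL q (SPoly D) = (-1) ^ p * (p.factorial * ∑ᶠ i : ℤ, h i) := by
    rw [hS, hq, LL_monic p Q hXm hX, LL_rowPoly h hfin]
  let s : Finset (ℤ × ℤ) :=
    Finset.univ.biUnion fun k => (hP k).diagram.finite.toFinset
  have hs : ∀ k, Function.support (P k) ⊆ s := by
    intro k x hx
    simp only [s, Finset.coe_biUnion, Set.mem_iUnion]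
    exact ⟨k, by simp, by simpa using hx⟩
  have hsD : Function.support D ⊆ s := by
    intro x hx
    by_contra hxs
    apply hx
    rw [hDsum, Finset.sum_apply]
    refine Finset.sum_eq_zero fun k _ => ?_
    have : P k x = 0 := by
      by_contra h0
      exact hxs (hs k h0)
    simp [this]
  have e2 : LL q (SPoly D) = ∑ k, a k * LL q (SPoly (P k)) := by
    rw [LL_SPoly q D s hsD]
    simp_rw [fun k => LL_SPoly q (P k) s (hs k), Finset.mul_sum]
    rw [Finset.sum_comm]
    refine Finset.sum_congr rfl fun x _ => ?_
    rw [hDsum, Finset.sum_apply, Finset.mul_sum, Finset.sum_mul]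
    refine Finset.sum_congr rfl fun k _ => ?_
    simp only [Pi.smul_apply, smul_eq_mul]
    ring
  have e3 : ∀ k, LL q (SPoly (P k)) = (-1) ^ p * ∏ i : Fin p, (t k i.succ : ℚ) := fun k =>
    pure_mult p (t k) (P k) (hP k) (ht0 k) (hPnorm k) Q hXm hX
  have e4 : (p.factorial : ℚ) * ∑ᶠ i : ℤ, h i = ∑ k, a k * ∏ i : Fin p, (t k i.succ : ℚ) := by
    have hne : ((-1 : ℚ)) ^ p ≠ 0 := pow_ne_zero _ (by norm_num)
    apply mul_left_cancel₀ hne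
    rw [← e1, e2, Finset.mul_sum]
    refine Finset.sum_congr rfl fun k _ => ?_
    rw [e3]; ring
  have hD0 : D (0, 0) = ∑ k, a k := by
    rw [hDsum, Finset.sum_apply]
    simp [hPnorm]
  have hf : (0 : ℚ) < p.factorial := by exact_mod_cast p.factorial_pos
  rw [← mul_div_assoc, le_div_iff₀ hf, mul_comm, e4, hD0, Finset.sum_mul]
  refine Finset.sum_le_sum fun k _ => mul_le_mul_of_nonneg_left ?_ (ha k)
  refine Finset.prod_le_prod (fun i _ => ?_) (fun i _ => ?_)
  · have := (hP k).strictMono (Fin.succ_pos i)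
    rw [ht0 k] at this
    exact_mod_cast this.le
  · exact_mod_cast htle k i.succ
end
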